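/- Let m, p, k be positive integers with p odd and m + p + 2k − 1 ≤ n. Let α be the partial injection of X_n with dom α = {1, …, m − 2} ∪ {m, …, m + p} ∪ {m + p + 2k + 1, …, n}, where xα = x for x ≤ m − 2 and for x ≥ m + p + 2k + 1, and xα = 2m + p + 2k − 1 − x for m ≤ x ≤ m + p (so mα = m + p + 2k − 1 and (m + p)α = m + 2k − 1). Then α ∈ ⟨J⟩ and α⁻¹ ∈ ⟨J⟩. -/

import Mathlib

/-!
Common framework: partial injections on `X_n = {1, …, n}`, the fence order,
fence-preserving partial injections, the semigroups `PFI_n`, `IF_n`,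
the set `J` of elements of rank at least `n - 2`, and (for even `n`)
the generating system `G`.
-/

namespace FencePaper

/-- The fence (zigzag) order on `{1, …, n}`: `a <_f b` iff `|a - b| = 1` and `b` is even. -/
def fenceLt (a b : ℕ) : Prop := (a + 1 = b ∨ b + 1 = a) ∧ Even b

/-- A partial injection of `X_n = {1, …, n}`, given by its graph. -/
structure PartialInj (n : ℕ) where
  graph : Set (ℕ × ℕ)
  mem_le : ∀ p ∈ graph, 1 ≤ p.1 ∧ p.1 ≤ n ∧ 1 ≤ p.2 ∧ p.2 ≤ n
  functional : ∀ p ∈ graph, ∀ q ∈ graph, p.1 = q.1 → p.2 = q.2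
  injOn : ∀ p ∈ graph, ∀ q ∈ graph, p.2 = q.2 → p.1 = q.1

namespace PartialInj

variable {n : ℕ}

theorem ext' {α β : PartialInj n} (h : α.graph = β.graph) : α = β := by
  cases α
  cases β
  simp only at h
  subst h
  rfl

/-- The domain of a partial injection. -/
def dom (α : PartialInj n) : Set ℕ := {x | ∃ y, (x, y) ∈ α.graph}

/-- The image (range) of a partial injection. -/
def im (α : PartialInj n) : Set ℕ := {y | ∃ x, (x, y) ∈ α.graph}

/-- The rank of a partial injection: the cardinality of its image. -/
noncomputable def rank (α : PartialInj n) : ℕ := α.im.ncard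

/-- The inverse partial injection. -/
def inv (α : PartialInj n) : PartialInj n where
  graph := {p | (p.2, p.1) ∈ α.graph}
  mem_le := by
    rintro p hp
    obtain ⟨h1, h2, h3, h4⟩ := α.mem_le _ hp
    exact ⟨h3, h4, h1, h2⟩
  functional := by
    rintro p hp q hq h
    exact α.injOn _ hp _ hq h
  injOn := by
    rintro p hp q hq h
    exact α.functional _ hp _ hq h

/-- Composition: first `α`, then `β` (maps act on the right). -/
def comp (α β : PartialInj n) : PartialInj n where
  graph := {p | ∃ y, (p.1, y) ∈ α.graph ∧ (y, p.2) ∈ β.graph}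
  mem_le := by
    rintro p ⟨y, h1, h2⟩
    obtain ⟨a, b, -, -⟩ := α.mem_le _ h1
    obtain ⟨-, -, c, d⟩ := β.mem_le _ h2
    exact ⟨a, b, c, d⟩
  functional := by
    rintro p ⟨y, h1, h2⟩ q ⟨z, h3, h4⟩ h
    have hyz : y = z := α.functional _ h1 _ h3 h
    subst hyz
    exact β.functional (y, p.2) h2 (y, q.2) h4 rfl
  injOn := by
    rintro p ⟨y, h1, h2⟩ q ⟨z, h3, h4⟩ h
    have hyz : y = z := β.injOn _ h2 _ h4 h
    subst hyz
    exact α.injOn (p.1, y) h1 (q.1, y) h3 rfl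

/-- The partial identity map on `D ∩ {1, …, n}`. -/
def pid (n : ℕ) (D : Set ℕ) : PartialInj n where
  graph := {p | p.1 ∈ Set.Icc 1 n ∧ p.1 ∈ D ∧ p.2 = p.1}
  mem_le := by
    rintro p ⟨⟨h1, h2⟩, -, h3⟩
    refine ⟨h1, h2, ?_, ?_⟩ <;> omega
  functional := by
    rintro p ⟨-, -, h1⟩ q ⟨-, -, h2⟩ h
    rw [h1, h2, h]
  injOn := by
    rintro p ⟨-, -, h1⟩ q ⟨-, -, h2⟩ h
    rw [← h1, ← h2, h]

instance : Monoid (PartialInj n) where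
  mul := comp
  one := pid n (Set.Icc 1 n)
  mul_assoc a b c := by
    apply ext'
    ext q
    constructor
    · rintro ⟨y, ⟨z, h1, h2⟩, h3⟩
      exact ⟨z, h1, y, h2, h3⟩
    · rintro ⟨z, h1, y, h2, h3⟩
      exact ⟨y, ⟨z, h1, h2⟩, h3⟩
  one_mul a := by
    apply ext'
    ext q
    constructor
    · rintro ⟨y, ⟨-, -, h⟩, h2⟩
      have hy : y = q.1 := h
      rw [hy] at h2
      exact h2
    · intro hq
      obtain ⟨h1, h2, -, -⟩ := a.mem_le _ hq
      exact ⟨q.1, ⟨⟨h1, h2⟩, ⟨h1, h2⟩, rfl⟩, hq⟩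
  mul_one a := by
    apply ext'
    ext q
    constructor
    · rintro ⟨y, h1, ⟨-, -, h⟩⟩
      have hy : q.2 = y := h
      rw [← hy] at h1
      exact h1
    · intro hq
      obtain ⟨-, -, h3, h4⟩ := a.mem_le _ hq
      exact ⟨q.2, hq, ⟨h3, h4⟩, ⟨h3, h4⟩, rfl⟩

theorem mul_graph (α β : PartialInj n) :
    (α * β).graph = {p | ∃ y, (p.1, y) ∈ α.graph ∧ (y, p.2) ∈ β.graph} := rfl

/-- `α` is fence-preserving. -/
def FP (α : PartialInj n) : Prop :=
  ∀ p ∈ α.graph, ∀ q ∈ α.graph, fenceLt p.1 q.1 → fenceLt p.2 q.2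

/-- The image of a subset under a partial injection. -/
def imageOf (α : PartialInj n) (S : Set ℕ) : Set ℕ := {y | ∃ x ∈ S, (x, y) ∈ α.graph}

end PartialInj

open PartialInj

/-- `PFI_n`: the semigroup of all fence-preserving partial injections. -/
def PFIset (n : ℕ) : Set (PartialInj n) := {α | α.FP}

/-- `IF_n = {α ∈ PFI_n : α⁻¹ ∈ PFI_n}`. -/
def IFset (n : ℕ) : Set (PartialInj n) := {α | α.FP ∧ α.inv.FP}

/-- `J = {α ∈ IF_n : rank α ≥ n - 2}`. -/
def Jset (n : ℕ) : Set (PartialInj n) := {α | α ∈ IFset n ∧ n - 2 ≤ α.rank}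

/-- `A` is a maximal block of consecutive integers of `D ⊆ {1, …, n}`. -/
def IsBlock (n : ℕ) (D A : Set ℕ) : Prop :=
  ∃ i r : ℕ, 1 ≤ i ∧ A = Set.Icc i (i + r) ∧ A ⊆ D ∧
    (i = 1 ∨ i - 1 ∉ D) ∧ (i + r = n ∨ i + r + 1 ∉ D)

/-- `α(k)`: the maximal blocks of `dom α` of cardinality `k`. -/
def blockSet {n : ℕ} (α : PartialInj n) (k : ℕ) : Set (Set ℕ) :=
  {A | IsBlock n α.dom A ∧ A.ncard = k}

/-- `α°(2k+1)`: the maximal blocks `{i, …, i+2k}` of `dom α` with `i` odd. -/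
def oddBlockSet {n : ℕ} (α : PartialInj n) (k : ℕ) : Set (Set ℕ) :=
  {A | A ∈ blockSet α (2 * k + 1) ∧ Odd (sInf A)}

/-- The graph of `σ₁`: domain `X_n ∖ {2}`, `1 ↦ n`, `x ↦ x - 2` for `3 ≤ x ≤ n`. -/
def sigma1Graph (n : ℕ) : Set (ℕ × ℕ) :=
  {q | 1 ≤ q.1 ∧ q.1 ≤ n ∧ q.1 ≠ 2 ∧ q.2 = if q.1 = 1 then n else q.1 - 2}

/-- The graph of `σ₂ = σ₁⁻¹`: domain `X_n ∖ {n-1}`, `x ↦ x + 2` for `x ≤ n - 2`, `n ↦ 1`. -/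
def sigma2Graph (n : ℕ) : Set (ℕ × ℕ) :=
  {q | 1 ≤ q.1 ∧ q.1 ≤ n ∧ q.1 ≠ n - 1 ∧ q.2 = if q.1 = n then 1 else q.1 + 2}

/-- The graph of `γ_i`: domain `X_n ∖ {i}`, `x ↦ i - x` for `x < i`, `x ↦ x` for `x > i`. -/
def gammaGraph (n i : ℕ) : Set (ℕ × ℕ) :=
  {q | 1 ≤ q.1 ∧ q.1 ≤ n ∧ q.1 ≠ i ∧ q.2 = if q.1 < i then i - q.1 else q.1}

/-- The graph of `δ_i`: domain `X_n ∖ {i}`, `x ↦ x` for `x < i`, `x ↦ n + i + 1 - x` for `x > i`. -/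
def deltaGraph (n i : ℕ) : Set (ℕ × ℕ) :=
  {q | 1 ≤ q.1 ∧ q.1 ≤ n ∧ q.1 ≠ i ∧ q.2 = if q.1 < i then q.1 else n + i + 1 - q.1}

/-- The graph of `β_{i,j}`: domain `X_n ∖ {i, j}`, reversing the interval strictly
between `i` and `j` and fixing everything else. -/
def betaGraph (n i j : ℕ) : Set (ℕ × ℕ) :=
  {q | 1 ≤ q.1 ∧ q.1 ≤ n ∧ q.1 ≠ i ∧ q.1 ≠ j ∧
    q.2 = if i < q.1 ∧ q.1 < j then i + j - q.1 else q.1}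

/-- The generating system `G` (for even `n`), given elements `σ₁, σ₂` and families
`γ, δ` realizing the prescribed graphs. -/
def Gset (n : ℕ) (σ₁ σ₂ : PartialInj n) (γ δ : ℕ → PartialInj n) : Set (PartialInj n) :=
  {pid n (Set.Icc 1 n), σ₁, σ₂} ∪
    {g | ∃ i, Even i ∧ 4 ≤ i ∧ i ≤ n ∧ g = γ i} ∪
    {g | ∃ i, Odd i ∧ i ≤ n - 3 ∧ g = δ i}

namespace PartialInj

variable {n : ℕ}

theorem pid_mul_pid (A B : Set ℕ) : pid n A * pid n B = pid n (A ∩ B) := by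
  apply ext'
  rw [mul_graph]
  ext ⟨x, y⟩
  constructor
  · rintro ⟨z, ⟨hx, hA, hz⟩, -, hB, hy⟩
    simp only at hz hy hx hA hB
    subst hz hy
    exact ⟨hx, ⟨hA, hB⟩, rfl⟩
  · rintro ⟨hx, ⟨hA, hB⟩, hy⟩
    simp only at hy hx hA hB
    subst hy
    exact ⟨y, ⟨hx, hA, rfl⟩, hx, hB, rfl⟩

theorem inv_mul (α β : PartialInj n) : (α * β).inv = β.inv * α.inv := by
  apply ext'
  ext q
  exact exists_congr fun _ => and_comm

theorem pid_inv (D : Set ℕ) : (pid n D).inv = pid n D := by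
  apply ext'
  ext ⟨x, y⟩
  constructor
  all_goals
    rintro ⟨hx, hD, h⟩
    simp only at h hx hD
    subst h
    exact ⟨hx, hD, rfl⟩

theorem pid_fp (D : Set ℕ) : (pid n D).FP := by
  rintro p ⟨-, -, hp⟩ q ⟨-, -, hq⟩ h
  rwa [hp, hq]

/-- A partial injection whose image misses at most two points of `X_n` has rank at least `n - 2`. -/
theorem sub_two_le_rank (α : PartialInj n) (i j : ℕ)
    (h : Set.Icc 1 n \ {i, j} ⊆ α.im) : n - 2 ≤ α.rank := by
  have hfin : α.im.Finite := (Set.finite_Icc 1 n).subset fun y ⟨x, hxy⟩ =>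
    (α.mem_le _ hxy).2.2
  have hpair : ({i, j} : Set ℕ).ncard ≤ 2 :=
    (Set.ncard_insert_le i {j}).trans (by rw [Set.ncard_singleton])
  have hdiff := Set.le_ncard_sdiff ({i, j} : Set ℕ) (Set.Icc 1 n)
  have hle := Set.ncard_le_ncard h hfin
  have hcard : (Set.Icc 1 n).ncard = n := by
    rw [← Finset.coe_Icc, Set.ncard_coe_finset, Nat.card_Icc, Nat.add_sub_cancel]
  unfold rank
  omega

/-- The map `β_{i,j}`, where `i = 0` and `j = n + 1` are allowed. -/
def beta (n i j : ℕ) (hj : j ≤ n + 1) : PartialInj n where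
  graph := betaGraph n i j
  mem_le := by
    rintro ⟨x, y⟩ ⟨h1, h2, h3, h4, h5⟩
    simp only at *
    split_ifs at h5 <;> omega
  functional := by
    rintro ⟨x, y⟩ ⟨-, -, -, -, h⟩ ⟨x', y'⟩ ⟨-, -, -, -, h'⟩ hx
    simp only at *
    rw [h, h', hx]
  injOn := by
    rintro ⟨x, y⟩ ⟨h1, h2, h3, h4, h5⟩ ⟨x', y'⟩ ⟨h1', h2', h3', h4', h5'⟩ hy
    simp only at *
    split_ifs at h5 h5' <;> omega

theorem beta_inv (i j : ℕ) (hj : j ≤ n + 1) : (beta n i j hj).inv = beta n i j hj := by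
  apply ext'
  ext ⟨x, y⟩
  constructor
  all_goals
    rintro ⟨h1, h2, h3, h4, h5⟩
    simp only at *
    refine ⟨?_, ?_, ?_, ?_, ?_⟩ <;> simp only <;> split_ifs at * <;> omega

theorem beta_fp (i j : ℕ) (hj : j ≤ n + 1) (hij : Even (i + j)) : (beta n i j hj).FP := by
  rintro ⟨x, y⟩ ⟨h1, h2, h3, h4, h5⟩ ⟨x', y'⟩ ⟨h1', h2', h3', h4', h5'⟩ ⟨h, he⟩
  rw [Nat.even_iff] at hij he
  simp only at *
  refine ⟨?_, Nat.even_iff.mpr ?_⟩ <;> split_ifs at * <;> omega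

end PartialInj

theorem pid_compl_singleton_mem_Jset (n a : ℕ) : pid n {a}ᶜ ∈ Jset n := by
  refine ⟨⟨pid_fp _, (pid_inv (n := n) {a}ᶜ).symm ▸ pid_fp _⟩, sub_two_le_rank _ a a ?_⟩
  rintro x ⟨hx, hxa⟩
  exact ⟨x, hx, fun h => hxa (Or.inl h), rfl⟩

theorem pid_mem_closure_Jset (n : ℕ) (D : Set ℕ) :
    pid n D ∈ Subsemigroup.closure (Jset n) := by
  have hcompl : ∀ F : Finset ℕ, pid n (F : Set ℕ)ᶜ ∈ Subsemigroup.closure (Jset n) := by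
    intro F
    induction F using Finset.induction with
    | empty =>
      refine Subsemigroup.subset_closure
        ⟨⟨pid_fp _, (pid_inv (n := n) _).symm ▸ pid_fp _⟩, sub_two_le_rank _ 0 0 ?_⟩
      rintro x ⟨hx, -⟩
      exact ⟨x, hx, by simp, rfl⟩
    | insert a F _ ih =>
      have h : ((insert a F : Finset ℕ) : Set ℕ)ᶜ = {a}ᶜ ∩ (F : Set ℕ)ᶜ := by
        ext x
        simp
      rw [h, ← pid_mul_pid]
      exact mul_mem (Subsemigroup.subset_closure (pid_compl_singleton_mem_Jset n a)) ih
  have hfin : (Set.Icc 1 n \ D).Finite := (Set.finite_Icc 1 n).sdiff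
  have hD : pid n D = pid n (hfin.toFinset : Set ℕ)ᶜ := by
    apply ext'
    ext q
    refine and_congr_right fun hq => and_congr_left fun _ => ?_
    rw [hfin.coe_toFinset]
    exact ⟨fun h h' => h'.2 h, fun h => by_contra fun h' => h ⟨hq, h'⟩⟩
  rw [hD]
  exact hcompl _

theorem beta_mem_Jset {n i j : ℕ} (hj : j ≤ n + 1) (hij : Even (i + j)) :
    beta n i j hj ∈ Jset n := by
  refine ⟨⟨beta_fp i j hj hij, (beta_inv i j hj).symm ▸ beta_fp i j hj hij⟩,
    sub_two_le_rank _ i j ?_⟩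
  rintro x ⟨⟨h1, h2⟩, hx⟩
  have hxi : x ≠ i := fun h => hx (Or.inl h)
  have hxj : x ≠ j := fun h => hx (Or.inr h)
  change ∃ z, (z, x) ∈ (beta n i j hj).graph
  have hmem : (x, if i < x ∧ x < j then i + j - x else x) ∈ (beta n i j hj).inv.graph := by
    rw [beta_inv]
    exact ⟨h1, h2, hxi, hxj, rfl⟩
  exact ⟨_, hmem⟩

/-- Corollary 3: with `p` odd, the reversing shift `x ↦ 2m + p + 2k - 1 - x` of
`{m, …, m+p}` lies in `⟨J⟩`. -/
theorem cor3 (n m p k : ℕ) (hm : 1 ≤ m) (hp : 1 ≤ p) (hk : 1 ≤ k) (hpodd : Odd p)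
    (hmp : m + p + 2 * k - 1 ≤ n) (α : PartialInj n)
    (hgraph : α.graph = {q : ℕ × ℕ |
      q.1 ∈ Set.Icc 1 (m - 2) ∪ Set.Icc m (m + p) ∪ Set.Icc (m + p + 2 * k + 1) n ∧
      q.2 = if m ≤ q.1 ∧ q.1 ≤ m + p then 2 * m + p + 2 * k - 1 - q.1 else q.1}) :
    α ∈ Subsemigroup.closure (Jset n) ∧ α.inv ∈ Subsemigroup.closure (Jset n) := by
  have hj : m + p + 2 * k ≤ n + 1 := by omega
  have hij : Even (m - 1 + (m + p + 2 * k)) := by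
    rw [Nat.odd_iff] at hpodd
    rw [Nat.even_iff]
    omega
  have hα : α = pid n α.dom * beta n (m - 1) (m + p + 2 * k) hj := by
    apply ext'
    rw [mul_graph]
    ext ⟨x, y⟩
    constructor
    · intro h
      obtain ⟨h1, h2, -, -⟩ := α.mem_le _ h
      refine ⟨x, ⟨⟨h1, h2⟩, ⟨y, h⟩, rfl⟩, ?_⟩
      rw [hgraph] at h
      obtain ⟨(⟨h3, h4⟩ | ⟨h3, h4⟩) | ⟨h3, h4⟩, h5⟩ := h
      all_goals
        simp only at *
        refine ⟨h1, h2, ?_, ?_, ?_⟩ <;> simp only <;> split_ifs at * <;> omega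
    · rintro ⟨z, ⟨-, ⟨w, hw⟩, hz⟩, -, -, -, -, h⟩
      simp only at hz hw h
      subst hz
      rw [hgraph] at hw ⊢
      refine ⟨hw.1, ?_⟩
      obtain ⟨(⟨h3, h4⟩ | ⟨h3, h4⟩) | ⟨h3, h4⟩, -⟩ := hw
      all_goals
        simp only at *
        split_ifs at * <;> omega
  have hβ := Subsemigroup.subset_closure (beta_mem_Jset hj hij)
  have hpid := pid_mem_closure_Jset n α.dom
  constructor
  · rw [hα]
    exact mul_mem hpid hβ
  · rw [hα, inv_mul, beta_inv, pid_inv]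
    exact mul_mem hβ hpid

end FencePaper
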